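/- Define the perturbed map T̃ coordinatewise by T̃_{kj}(y) = min{ y_{kj} − h(y_k), −A_{kj}(y)·e^{h(y_k)} }, and let B = [−M, 0]^{m×n} with M = 2V + 1 and V = Σ_{ℓ,i} v_{ℓi}. Then T̃ is continuous, maps B into B, and admits a fixed point: there exists y ∈ B with T̃(y) = y. -/

import Mathlib

/-- Max of a row: `h(z) = max_r z_r` (realized as `sSup` of the finite range). -/
noncomputable def rowMax {n : ℕ} (z : Fin n → ℝ) : ℝ := sSup (Set.range z)

/-- The continuous-extension upper bound `g(x,λ)` from the paper. -/
noncomputable def gfun {m n : ℕ} (v x : Fin m → Fin n → ℝ) (lam : ℝ) : ℝ :=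
  (1 / lam) * Real.log
    (∑ p ∈ Finset.univ.filter (fun p : Fin n × Fin n => p.1 ≠ p.2),
      ∑ k : Fin m, x k p.2 *
        ∏ ℓ ∈ Finset.univ.erase k,
          (1 - x ℓ p.1 - x ℓ p.2 + x ℓ p.1 * Real.exp (-lam * v ℓ p.1)
            + x ℓ p.2 * Real.exp (lam * v ℓ p.1)))

/-- `X` is an EFX allocation: a partition of the goods such that for all agents
`i, j` and every good `k ∈ X_j`, `Σ_{ℓ∈X_i} v_{ℓi} ≥ Σ_{ℓ∈X_j} v_{ℓi} − v_{ki}`. -/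
def IsEFX {m n : ℕ} (v : Fin m → Fin n → ℝ) (X : Fin n → Finset (Fin m)) : Prop :=
  (∀ i j, i ≠ j → Disjoint (X i) (X j)) ∧
  (Finset.univ.biUnion X = (Finset.univ : Finset (Fin m))) ∧
  (∀ i j : Fin n, ∀ k ∈ X j, (∑ ℓ ∈ X i, v ℓ i) ≥ (∑ ℓ ∈ X j, v ℓ i) - v k i)

/-- `A_{kj}(y) = max_{i≠j} Σ_{ℓ≠k} ( h(y_ℓ + v_{ℓi}(e_j − e_i)) − h(y_ℓ) )`. -/
noncomputable def Amap {m n : ℕ} (v y : Fin m → Fin n → ℝ) (k : Fin m) (j : Fin n) : ℝ :=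
  sSup { z : ℝ | ∃ i : Fin n, i ≠ j ∧
    z = ∑ ℓ ∈ Finset.univ.erase k,
      (rowMax (fun r => y ℓ r +
          v ℓ i * ((if r = j then (1 : ℝ) else 0) - (if r = i then (1 : ℝ) else 0)))
        - rowMax (y ℓ)) }

/-- The objective `f(y)` of Theorem `thm:f-y`; note that
`max{ y_{ℓi} − v_{ℓi}, y_{ℓj} + v_{ℓi}, max_{r∉{i,j}} y_{ℓr} }` is exactly the max of
the row `y_ℓ + v_{ℓi}(e_j − e_i)` (and when `n = 2` the innermost max is absent). -/
noncomputable def fobj {m n : ℕ} (v y : Fin m → Fin n → ℝ) : ℝ :=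
  sSup { z : ℝ | ∃ i j : Fin n, i ≠ j ∧ ∃ k : Fin m,
      z = y k j + ∑ ℓ ∈ Finset.univ.erase k,
        rowMax (fun r => y ℓ r +
          v ℓ i * ((if r = j then (1 : ℝ) else 0) - (if r = i then (1 : ℝ) else 0))) }
    - ∑ ℓ, rowMax (y ℓ)

section Dominance

variable {T I α : Type*} [LinearOrder α] {u : I → T → α} {σ τ : Finset T} {C D : Finset I}

/-- The pair `(σ, C)` is dominant for the utilities `u` when no point is, for every `i ∈ C`,
strictly better than the `u i`-worst point of `σ`. -/
def IsDominant (u : I → T → α) (σ : Finset T) (C : Finset I) : Prop :=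
  ∀ y, ∃ i ∈ C, ∀ x ∈ σ, u i y ≤ u i x

theorem IsDominant.mono (h : IsDominant u σ C) (hσ : τ ⊆ σ) (hC : C ⊆ D) : IsDominant u τ D := by
  intro y
  obtain ⟨i, hi, hy⟩ := h y
  exact ⟨i, hC hi, fun x hx => hy x (hσ hx)⟩

/-- If every point of `σ` minimizes one of the `u i` with `i ∈ C`, and `C` is no larger than `σ`,
then distinct indices in `C` have distinct minimizers. -/
theorem eq_of_common_minimizer [DecidableEq I] (hu : ∀ i, Function.Injective (u i))
    (h : ∀ x ∈ σ, ∃ i ∈ C, ∀ x' ∈ σ, u i x ≤ u i x') (hcard : C.card ≤ σ.card)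
    {x : T} (hx : x ∈ σ) {i j : I} (hi : i ∈ C) (hj : j ∈ C)
    (hix : ∀ x' ∈ σ, u i x ≤ u i x') (hjx : ∀ x' ∈ σ, u j x ≤ u j x') : i = j := by
  by_contra hij
  have key : σ.card ≤ (C.erase i).card := by
    have h2 : ∀ z ∈ σ, ∃ k ∈ C.erase i, ∀ x' ∈ σ, u k z ≤ u k x' := by
      intro z hz
      obtain ⟨k, hk, hkz⟩ := h z hz
      by_cases hki : k = i
      · subst hki
        obtain rfl : z = x := hu k (le_antisymm (hkz x hx) (hix z hz))
        exact ⟨j, by simp [hj, Ne.symm hij], hjx⟩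
      · exact ⟨k, by simp [hk, hki], hkz⟩
    have : Nonempty I := ⟨i⟩
    choose! g hg hg' using h2
    refine Finset.card_le_card_of_injOn g hg fun z hz w hw hzw => ?_
    refine hu (g z) (le_antisymm (hg' z hz w hw) ?_)
    rw [hzw]
    exact hg' w hw z hz
  rw [Finset.card_erase_of_mem hi] at key
  have := Finset.card_pos.2 ⟨i, hi⟩
  omega

variable [DecidableEq T] [DecidableEq I]

/-- `(τ, D)` is a facet of `(σ, C)`: it arises by deleting a point or by adding an index. -/
def IsFacet (d r : Finset T × Finset I) : Prop :=
  (∃ x ∉ d.1, r.1 = insert x d.1 ∧ r.2 = d.2) ∨ (∃ a ∉ r.2, d.2 = insert a r.2 ∧ d.1 = r.1)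

/-- The pair `r` is dominant and arises from `d` by a pivot along the index `i`. -/
def IsPivot (u : I → T → α) (i : I) (d r : Finset T × Finset I) : Prop :=
  IsDominant u r.1 r.2 ∧ ((r.1 = d.1 ∧ r.2 = d.2.erase i) ∨
    ∃ y ∉ d.1, r.1 = insert y d.1 ∧ r.2 = d.2 ∧ ∀ k ∈ d.2.erase i, ∃ x ∈ d.1, u k x < u k y)

theorem IsPivot.isFacet {i : I} {d r : Finset T × Finset I} (hi : i ∈ d.2) (h : IsPivot u i d r) :
    IsFacet d r := by
  rcases h.2 with ⟨h1, h2⟩ | ⟨y, hy, h1, h2, -⟩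
  · exact Or.inr ⟨i, by simp [h2], by simp [h2, Finset.insert_erase hi], h1.symm⟩
  · exact Or.inl ⟨y, hy, h1, h2⟩

theorem existsUnique_isPivot [Finite T] (hu : ∀ i, Function.Injective (u i)) {i : I}
    {d : Finset T × Finset I} (hd : IsDominant u d.1 d.2)
    (hred : ∀ x ∈ d.1, ∃ k ∈ d.2.erase i, ∀ x' ∈ d.1, u k x ≤ u k x') :
    ∃! r, IsPivot u i d r := by
  obtain ⟨τ, D⟩ := d
  dsimp only at hd hred
  have hlast : ∀ y, (∀ k ∈ D.erase i, ∃ x ∈ τ, u k x < u k y) →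
      i ∈ D ∧ ∀ x ∈ τ, u i y ≤ u i x := by
    intro y hy
    obtain ⟨k, hk, hky⟩ := hd y
    by_cases hki : k = i
    · exact hki ▸ ⟨hk, hky⟩
    · obtain ⟨x, hx, hxy⟩ := hy k (by simp [hk, hki])
      exact absurd (hky x hx) (not_le.2 hxy)
  by_cases hdom : IsDominant u τ (D.erase i)
  · refine ⟨(τ, D.erase i), ⟨hdom, Or.inl ⟨rfl, rfl⟩⟩, ?_⟩
    rintro ⟨σ, C⟩ ⟨-, ⟨h1, h2⟩ | ⟨y, -, -, -, hy⟩⟩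
    · simp_all
    · obtain ⟨k, hk, hky⟩ := hdom y
      obtain ⟨x, hx, hxy⟩ := hy k hk
      exact absurd (hky x hx) (not_le.2 hxy)
  · let M : Set T := {y | ∀ k ∈ D.erase i, ∃ x ∈ τ, u k x < u k y}
    have hM : M.Nonempty := by
      unfold IsDominant at hdom
      push Not at hdom
      exact hdom
    obtain ⟨y, hyM, hymax⟩ := Set.exists_max_image M (u i) (Set.toFinite M) hM
    have hmem : ∀ z ∈ M, z ∉ τ := by
      intro z hz hzτ
      obtain ⟨k, hk, hkz⟩ := hred z hzτ
      obtain ⟨x, hx, hxz⟩ := hz k hk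
      exact absurd (hkz x hx) (not_le.2 hxz)
    refine ⟨(insert y τ, D), ⟨fun z => ?_, Or.inr ⟨y, hmem y hyM, rfl, rfl, hyM⟩⟩, ?_⟩
    · by_cases hz : z ∈ M
      · refine ⟨i, (hlast z hz).1, fun x hx => ?_⟩
        rcases Finset.mem_insert.1 hx with rfl | hx
        · exact hymax z hz
        · exact (hlast z hz).2 x hx
      · simp only [M, Set.mem_ofPred_eq, not_forall, not_exists, not_and, not_lt] at hz
        obtain ⟨k, hk, hkz⟩ := hz
        refine ⟨k, Finset.mem_of_mem_erase hk, fun x hx => ?_⟩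
        rcases Finset.mem_insert.1 hx with rfl | hx
        · obtain ⟨w, hw, hwx⟩ := hyM k hk
          exact (hkz w hw).trans hwx.le
        · exact hkz x hx
    · rintro ⟨σ, C⟩ ⟨hσ, ⟨h1, h2⟩ | ⟨z, -, h1, h2, hz⟩⟩
      · dsimp only at h1 h2 hσ
        exact absurd (h1 ▸ h2 ▸ hσ) hdom
      · dsimp only at h1 h2 hσ hz
        subst h1 h2
        have hzy : u i y ≤ u i z := by
          obtain ⟨k, hk, hky⟩ := hσ y
          by_cases hki : k = i
          · exact hki ▸ hky z (Finset.mem_insert_self _ _)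
          · obtain ⟨x, hx, hxy⟩ := hyM k (by simp [hk, hki])
            exact absurd (hky x (Finset.mem_insert_of_mem hx)) (not_le.2 hxy)
        rw [hu i (le_antisymm hzy (hymax z hz))]

theorem not_isPivot_of_isPivot {a b : I} (hab : a ≠ b) {d r : Finset T × Finset I}
    (hd : IsDominant u d.1 d.2) (ha : a ∈ d.2) (h : IsPivot u a d r) : ¬ IsPivot u b d r := by
  obtain ⟨τ, D⟩ := d
  obtain ⟨σ, C⟩ := r
  intro h'
  rcases h.2 with ⟨h1, h2⟩ | ⟨y, hy, h1, h2, hya⟩ <;>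
    rcases h'.2 with ⟨h3, h4⟩ | ⟨z, hz, h3, h4, hzb⟩ <;> dsimp only at *
  · have : a ∈ D.erase b := by simp [ha, hab]
    rw [← h4, h2] at this
    simp at this
  · exact hz (by rw [← h1, h3]; simp)
  · exact hy (by rw [← h3, h1]; simp)
  · obtain rfl : y = z := by
      have : y ∈ insert z τ := by rw [← h3, h1]; simp
      exact (Finset.mem_insert.1 this).resolve_right hy
    obtain ⟨k, hk, hky⟩ := hd y
    have : ∃ x ∈ τ, u k x < u k y := by
      by_cases hka : k = a
      · exact hzb k (by simp [hka, ha, hab])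
      · exact hya k (by simp [hk, hka])
    obtain ⟨x, hx, hxy⟩ := this
    exact absurd (hky x hx) (not_le.2 hxy)

/-- A dominant pair having `d` as a facet is a pivot along some index `i` of `d` such that every
point of `d.1` minimizes one of the remaining utilities. -/
theorem IsFacet.exists_isPivot (hu : ∀ i, Function.Injective (u i)) {d r : Finset T × Finset I}
    (h : IsFacet d r) (hr : IsDominant u r.1 r.2) (hcard : d.2.card = d.1.card + 1) :
    ∃ i ∈ d.2, IsPivot u i d r ∧
      ∀ x ∈ d.1, ∃ k ∈ d.2.erase i, ∀ x' ∈ d.1, u k x ≤ u k x' := by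
  obtain ⟨τ, D⟩ := d
  obtain ⟨σ, C⟩ := r
  rcases h with ⟨y, hy, h1, h2⟩ | ⟨a, ha, h1, h2⟩ <;> dsimp only at *
  · subst h1 h2
    have hcard' : C.card = (insert y τ).card := by rw [Finset.card_insert_of_notMem hy, hcard]
    obtain ⟨i, hi, hiy⟩ := hr y
    have hne : ∀ x ∈ τ, ∀ k ∈ C, (∀ x' ∈ insert y τ, u k x ≤ u k x') → k ∈ C.erase i := by
      intro x hx k hk hkx
      refine Finset.mem_erase.2 ⟨?_, hk⟩
      rintro rfl
      have : x = y := hu k (le_antisymm (hkx y (by simp)) (hiy x (by simp [hx])))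
      exact hy (this ▸ hx)
    refine ⟨i, hi, ⟨hr, Or.inr ⟨y, hy, rfl, rfl, ?_⟩⟩, ?_⟩
    · intro k hk
      by_contra hcon
      push Not at hcon
      refine (Finset.mem_erase.1 hk).1 (eq_of_common_minimizer hu (fun x _ => hr x) hcard'.le
        (Finset.mem_insert_self y τ) (Finset.mem_of_mem_erase hk) hi ?_ hiy)
      intro x hx
      rcases Finset.mem_insert.1 hx with rfl | hx
      · exact le_rfl
      · exact hcon x hx
    · intro x hx
      obtain ⟨k, hk, hkx⟩ := hr x
      exact ⟨k, hne x hx k hk hkx, fun x' hx' => hkx x' (Finset.mem_insert_of_mem hx')⟩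
  · subst h1 h2
    have : (insert a C).erase a = C := Finset.erase_insert ha
    exact ⟨a, Finset.mem_insert_self _ _, ⟨hr, Or.inl ⟨rfl, this.symm⟩⟩,
      fun x _ => this.symm ▸ hr x⟩

open scoped Classical in
/-- A dominant pair `d` with nonempty `d.1` and one more index than points is a facet of exactly
two dominant pairs. -/
theorem card_filter_isFacet_eq_two [Fintype T] [Fintype I] (hu : ∀ i, Function.Injective (u i))
    {d : Finset T × Finset I} (hd : IsDominant u d.1 d.2) (hcard : d.2.card = d.1.card + 1)
    (hne : d.1.Nonempty) :
    (Finset.univ.filter fun r : Finset T × Finset I =>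
      IsDominant u r.1 r.2 ∧ IsFacet d r).card = 2 := by
  have hp : ∀ i, ∃ x ∈ d.1, ∀ x' ∈ d.1, u i x ≤ u i x' :=
    fun i => Finset.exists_min_image d.1 (u i) hne
  choose p hp hpmin using hp
  obtain ⟨a, ha, b, hb, hab, hpab⟩ := Finset.exists_ne_map_eq_of_card_lt_of_maps_to
    (s := d.2) (t := d.1) (f := p) (by omega) (fun i _ => hp i)
  have hred : ∀ i j, i ∈ d.2 → j ∈ d.2 → i ≠ j → p i = p j →
      ∀ x ∈ d.1, ∃ k ∈ d.2.erase i, ∀ x' ∈ d.1, u k x ≤ u k x' := by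
    intro i j hi hj hij hpij x hx
    obtain ⟨k, hk, hkx⟩ := hd x
    by_cases hki : k = i
    · subst hki
      obtain rfl : x = p k := hu k (le_antisymm (hkx _ (hp k)) (hpmin k x hx))
      exact ⟨j, by simp [hj, hij.symm], hpij ▸ hpmin j⟩
    · exact ⟨k, by simp [hk, hki], hkx⟩
  have hredeq : ∀ i ∈ d.2, (∀ x ∈ d.1, ∃ k ∈ d.2.erase i, ∀ x' ∈ d.1, u k x ≤ u k x') →
      i = a ∨ i = b := by
    intro i hi h
    by_contra hcon
    push Not at hcon
    refine hab (eq_of_common_minimizer hu h ?_ (hp a) (by simp [ha, hcon.1.symm])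
      (by simp [hb, hcon.2.symm]) (hpmin a) (hpab ▸ hpmin b))
    rw [Finset.card_erase_of_mem hi]
    omega
  obtain ⟨ra, hra, hra'⟩ := existsUnique_isPivot hu hd (hred a b ha hb hab hpab)
  obtain ⟨rb, hrb, hrb'⟩ := existsUnique_isPivot hu hd (hred b a hb ha hab.symm hpab.symm)
  rw [Finset.card_eq_two]
  refine ⟨ra, rb, fun h => not_isPivot_of_isPivot hab hd ha hra (h ▸ hrb), ?_⟩
  ext r
  simp only [Finset.mem_filter, Finset.mem_univ, true_and, Finset.mem_insert,
    Finset.mem_singleton]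
  constructor
  · rintro ⟨hr, hf⟩
    obtain ⟨i, hi, hpiv, hi'⟩ := hf.exists_isPivot hu hr hcard
    rcases hredeq i hi hi' with rfl | rfl
    · exact Or.inl (hra' r hpiv)
    · exact Or.inr (hrb' r hpiv)
  · rintro (rfl | rfl)
    · exact ⟨hra.1, hra.isFacet ha⟩
    · exact ⟨hrb.1, hrb.isFacet hb⟩

open scoped Classical in
/-- The pair `(∅, {i})` is a facet of exactly one dominant pair. -/
theorem card_filter_isFacet_eq_one [Fintype T] [Fintype I]
    (hu : ∀ i, Function.Injective (u i)) (i : I) :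
    (Finset.univ.filter fun r : Finset T × Finset I =>
      IsDominant u r.1 r.2 ∧ IsFacet (∅, {i}) r).card = 1 := by
  have hd : IsDominant u (∅ : Finset T) {i} := fun y => ⟨i, by simp, by simp⟩
  obtain ⟨r₀, hr₀, huniq⟩ := existsUnique_isPivot (i := i) (d := (∅, {i})) hu hd (by simp)
  rw [Finset.card_eq_one]
  refine ⟨r₀, ?_⟩
  ext r
  simp only [Finset.mem_filter, Finset.mem_univ, true_and, Finset.mem_singleton]
  constructor
  · rintro ⟨hr, hf⟩
    obtain ⟨j, hj, hpiv, -⟩ := hf.exists_isPivot hu hr (by simp)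
    obtain rfl : j = i := by simpa using hj
    exact huniq r hpiv
  · rintro rfl
    exact ⟨hr₀.1, hr₀.isFacet (by simp)⟩

open scoped Classical in
/-- A pair with as many points as indices whose colours do not match its indices has an even
number of facets whose colours are exactly the indices other than `i₀`. -/
theorem even_card_filter_isFacet [Fintype T] [Fintype I] (c : T → I) (i₀ : I)
    {r : Finset T × Finset I} (hcard : r.1.card = r.2.card) (hc : r.1.image c ≠ r.2) :
    Even (Finset.univ.filter fun d : Finset T × Finset I =>
      (d.2.card = d.1.card + 1 ∧ i₀ ∈ d.2 ∧ d.1.image c = d.2.erase i₀) ∧ IsFacet d r).card := by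
  obtain ⟨σ, C⟩ := r
  dsimp only at hcard hc
  set S := Finset.univ.filter fun d : Finset T × Finset I =>
      (d.2.card = d.1.card + 1 ∧ i₀ ∈ d.2 ∧ d.1.image c = d.2.erase i₀) ∧ IsFacet d (σ, C) with hS
  have hmem : ∀ d, d ∈ S ↔ i₀ ∈ C ∧
      ((∃ x ∈ σ, d = (σ.erase x, C) ∧ (σ.erase x).image c = C.erase i₀) ∨
        ∃ a ∉ C, d = (σ, insert a C) ∧ σ.image c = insert a (C.erase i₀)) := by
    rintro ⟨τ, D⟩
    simp only [hS, Finset.mem_filter, Finset.mem_univ, true_and]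
    unfold IsFacet
    dsimp only
    constructor
    · rintro ⟨⟨h1, h2, h3⟩, ⟨x, hx, rfl, rfl⟩ | ⟨a, ha, rfl, rfl⟩⟩
      · exact ⟨h2, Or.inl ⟨x, by simp, by simp [Finset.erase_insert hx],
          by rw [Finset.erase_insert hx, h3]⟩⟩
      · have hne : a ≠ i₀ := by
          rintro rfl
          exact hc (by rw [h3, Finset.erase_insert ha])
        refine ⟨(Finset.mem_insert.1 h2).resolve_left hne.symm, Or.inr ⟨a, ha, rfl, ?_⟩⟩
        rw [h3, Finset.erase_insert_of_ne hne]
    · rintro ⟨hi, ⟨x, hx, h1, h2⟩ | ⟨a, ha, h1, h2⟩⟩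
      · obtain ⟨rfl, rfl⟩ := Prod.mk.inj h1
        refine ⟨⟨?_, hi, h2⟩, Or.inl ⟨x, by simp, by simp [Finset.insert_erase hx], rfl⟩⟩
        rw [Finset.card_erase_of_mem hx]
        have := Finset.card_pos.2 ⟨x, hx⟩
        omega
      · obtain ⟨rfl, rfl⟩ := Prod.mk.inj h1
        have hne : a ≠ i₀ := fun h => ha (h ▸ hi)
        refine ⟨⟨by rw [Finset.card_insert_of_notMem ha, hcard], by simp [hi], ?_⟩,
          Or.inr ⟨a, ha, rfl, rfl⟩⟩
        rw [h2, Finset.erase_insert_of_ne hne]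
  rcases S.eq_empty_or_nonempty with hE | ⟨d, hdS⟩
  · simp [hE]
  obtain ⟨hi, hd⟩ := (hmem d).1 hdS
  have hx : ∃ x ∈ σ, (σ.erase x).image c = C.erase i₀ := by
    rcases hd with ⟨x, hx, -, h⟩ | ⟨a, ha, -, h⟩
    · exact ⟨x, hx, h⟩
    · have hinj : Set.InjOn c σ := by
        rw [← Finset.card_image_iff, h, Finset.card_insert_of_notMem (by simp [ha]),
          Finset.card_erase_of_mem hi, hcard]
        have := Finset.card_pos.2 ⟨i₀, hi⟩
        omega
      obtain ⟨x, hx, rfl⟩ : ∃ x ∈ σ, c x = a := by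
        have : a ∈ σ.image c := by simp [h]
        simpa using this
      refine ⟨x, hx, ?_⟩
      ext k
      have hk := Finset.ext_iff.1 h k
      simp only [Finset.mem_image, Finset.mem_insert] at hk
      simp only [Finset.mem_image, Finset.mem_erase (s := σ)]
      constructor
      · rintro ⟨z, ⟨hzx, hz⟩, rfl⟩
        exact (hk.1 ⟨z, hz, rfl⟩).resolve_left fun h => hzx (hinj hz hx h)
      · intro hkC
        obtain ⟨z, hz, rfl⟩ := hk.2 (Or.inr hkC)
        refine ⟨z, ⟨?_, hz⟩, rfl⟩
        rintro rfl
        exact ha (Finset.mem_of_mem_erase hkC)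
  clear hd hdS d
  obtain ⟨x, hx, hxC⟩ := hx
  have hinj : Set.InjOn c (σ.erase x) := by
    rw [← Finset.card_image_iff, hxC, Finset.card_erase_of_mem hi, Finset.card_erase_of_mem hx,
      hcard]
  have himage : σ.image c = insert (c x) (C.erase i₀) := by
    rw [← hxC, ← Finset.image_insert, Finset.insert_erase hx]
  have hxi : c x ≠ i₀ := by
    intro h
    exact hc (by rw [himage, h, Finset.insert_erase hi])
  suffices S.card = 2 by rw [this]; exact even_two
  rw [Finset.card_eq_two]
  by_cases hcx : c x ∈ C
  · obtain ⟨w, hw, hwx⟩ : ∃ w ∈ σ.erase x, c w = c x := by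
      have : c x ∈ (σ.erase x).image c := by simp [hxC, hcx, hxi]
      simpa using this
    obtain ⟨hwne, hwσ⟩ := Finset.mem_erase.1 hw
    have hwC : (σ.erase w).image c = C.erase i₀ := by
      rw [← hxC]
      ext k
      simp only [Finset.mem_image, Finset.mem_erase]
      constructor
      · rintro ⟨z, ⟨hzw, hz⟩, rfl⟩
        by_cases hzx : z = x
        · exact ⟨w, ⟨hwne, hwσ⟩, by rw [hzx, hwx]⟩
        · exact ⟨z, ⟨hzx, hz⟩, rfl⟩
      · rintro ⟨z, ⟨hzx, hz⟩, rfl⟩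
        by_cases hzw : z = w
        · exact ⟨x, ⟨hwne.symm, hx⟩, by rw [hzw, hwx]⟩
        · exact ⟨z, ⟨hzw, hz⟩, rfl⟩
    refine ⟨(σ.erase x, C), (σ.erase w, C), ?_, ?_⟩
    · intro h
      have h' := (Prod.mk.inj h).1
      rw [h'] at hw
      simp at hw
    · ext d
      rw [hmem, Finset.mem_insert, Finset.mem_singleton]
      constructor
      · rintro ⟨-, ⟨z, hz, rfl, hzC⟩ | ⟨a, ha, -, h⟩⟩
        · by_cases hzx : z = x
          · exact Or.inl (by rw [hzx])
          · have hcz : c z ∈ (σ.erase z).image c := by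
              rw [hzC, ← hxC]
              exact Finset.mem_image_of_mem c (by simp [hz, hzx])
            obtain ⟨t, ht, htz⟩ := Finset.mem_image.1 hcz
            obtain ⟨htne, htσ⟩ := Finset.mem_erase.1 ht
            have htx : t = x := by
              by_contra htx
              exact htne (hinj (by simp [htx, htσ]) (by simp [hzx, hz]) htz)
            have hzw : z = w := hinj (by simp [hzx, hz]) hw (by rw [← htz, htx, hwx])
            exact Or.inr (by rw [hzw])
        · have : a ∈ insert (c x) (C.erase i₀) := by rw [← himage, h]; simp
          rcases Finset.mem_insert.1 this with rfl | h
          · exact absurd hcx ha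
          · exact absurd (Finset.mem_of_mem_erase h) ha
      · rintro (rfl | rfl)
        · exact ⟨hi, Or.inl ⟨x, hx, rfl, hxC⟩⟩
        · exact ⟨hi, Or.inl ⟨w, hwσ, rfl, hwC⟩⟩
  · refine ⟨(σ.erase x, C), (σ, insert (c x) C), ?_, ?_⟩
    · intro h
      have h' := (Prod.mk.inj h).2
      exact hcx (by rw [h']; simp)
    · ext d
      rw [hmem, Finset.mem_insert, Finset.mem_singleton]
      constructor
      · rintro ⟨-, ⟨z, hz, rfl, hzC⟩ | ⟨a, ha, rfl, h⟩⟩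
        · have hzx : z = x := by
            by_contra hzx
            have : c x ∈ (σ.erase z).image c :=
              Finset.mem_image_of_mem c (by simp [hx, Ne.symm hzx])
            rw [hzC] at this
            exact hcx (Finset.mem_of_mem_erase this)
          exact Or.inl (by rw [hzx])
        · have : a ∈ insert (c x) (C.erase i₀) := by rw [← himage, h]; simp
          rcases Finset.mem_insert.1 this with rfl | h
          · exact Or.inr rfl
          · exact absurd (Finset.mem_of_mem_erase h) ha
      · rintro (rfl | rfl)
        · exact ⟨hi, Or.inl ⟨x, hx, rfl, hxC⟩⟩
        · exact ⟨hi, Or.inr ⟨c x, hcx, rfl, himage⟩⟩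

/-- **Scarf's lemma**: for any colouring of finitely many points by the indices of finitely many
injective utilities, some dominant pair has matching colours and indices. -/
theorem exists_isDominant_image_eq [Fintype T] [Nonempty I] [Fintype I]
    (hu : ∀ i, Function.Injective (u i)) (c : T → I) :
    ∃ σ : Finset T, ∃ C : Finset I, IsDominant u σ C ∧ σ.image c = C := by
  classical
  by_contra hcon
  push Not at hcon
  obtain ⟨i₀⟩ := ‹Nonempty I›
  let rooms : Finset (Finset T × Finset I) :=
    Finset.univ.filter fun r => IsDominant u r.1 r.2 ∧ r.1.card = r.2.card
  let doors : Finset (Finset T × Finset I) :=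
    Finset.univ.filter fun d => IsDominant u d.1 d.2 ∧
      d.2.card = d.1.card + 1 ∧ i₀ ∈ d.2 ∧ d.1.image c = d.2.erase i₀
  have hcount := Finset.sum_card_bipartiteAbove_eq_sum_card_bipartiteBelow
    (s := doors) (t := rooms) IsFacet
  have hrooms : Even (∑ r ∈ rooms, (doors.bipartiteBelow IsFacet r).card) := by
    refine Finset.even_sum _ fun r hr => ?_
    simp only [rooms, Finset.mem_filter, Finset.mem_univ, true_and] at hr
    have h := even_card_filter_isFacet c i₀ hr.2 (hcon r.1 r.2 hr.1)
    refine (congrArg (fun s => Even (Finset.card s)) (Finset.ext fun d => ?_)).mpr h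
    simp only [doors, Finset.mem_bipartiteBelow, Finset.mem_filter, Finset.mem_univ, true_and]
    refine ⟨fun h => ⟨h.1.2, h.2⟩, fun h => ⟨⟨?_, h.1⟩, h.2⟩⟩
    rcases h.2 with ⟨x, -, h1, h2⟩ | ⟨a, -, h1, h2⟩
    · exact hr.1.mono (by simp [h1]) h2.le
    · exact hr.1.mono h2.le (by simp [h1])
  have habove : ∀ d ∈ doors, (rooms.bipartiteAbove IsFacet d).card =
      (Finset.univ.filter fun r : Finset T × Finset I =>
        IsDominant u r.1 r.2 ∧ IsFacet d r).card := by
    intro d hd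
    simp only [doors, Finset.mem_filter, Finset.mem_univ, true_and] at hd
    congr 1
    ext r
    simp only [rooms, Finset.mem_bipartiteAbove, Finset.mem_filter, Finset.mem_univ, true_and]
    refine ⟨fun h => ⟨h.1.1, h.2⟩, fun h => ⟨⟨h.1, ?_⟩, h.2⟩⟩
    have := hd.2.1
    rcases h.2 with ⟨x, hx, h1, h2⟩ | ⟨a, ha, h1, h2⟩
    · rw [h1, h2, Finset.card_insert_of_notMem hx, this]
    · rw [h1, h2, Finset.card_insert_of_notMem ha] at this
      omega
  have hout : ((∅, {i₀}) : Finset T × Finset I) ∈ doors := by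
    simp only [doors, Finset.mem_filter, Finset.mem_univ, true_and]
    exact ⟨fun y => ⟨i₀, by simp, by simp⟩, by simp, by simp, by simp⟩
  have hdoors : Odd (∑ d ∈ doors, (rooms.bipartiteAbove IsFacet d).card) := by
    rw [← Finset.add_sum_erase _ _ hout, habove _ hout, card_filter_isFacet_eq_one hu]
    refine Even.one_add (Finset.even_sum _ fun d hd => ?_)
    obtain ⟨hne, hd⟩ := Finset.mem_erase.1 hd
    rw [habove d hd]
    simp only [doors, Finset.mem_filter, Finset.mem_univ, true_and] at hd
    rw [card_filter_isFacet_eq_two hu hd.1 hd.2.1]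
    · exact even_two
    · rw [Finset.nonempty_iff_ne_empty]
      intro h0
      refine hne (Prod.ext h0 ?_)
      have h3 := hd.2.2.2
      rw [h0, Finset.image_empty] at h3
      rw [← Finset.insert_erase hd.2.2.1, ← h3]
      rfl
  rw [hcount] at hdoors
  exact (Nat.not_even_iff_odd.2 hdoors) hrooms

end Dominance

section Brouwer

open Filter Topology

variable {ι : Type*} [Fintype ι]

/-- The points of a dominant pair in the grid of `ℕ`-valued functions of sum `N` are close to each
other, and close to the face spanned by the indices of the pair. -/
theorem IsDominant.grid_bounds [DecidableEq ι] {α : Type*} [LinearOrder α] {N : ℕ}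
    {u : ι → (Finset.univ : Finset ι).piAntidiag N → α}
    (hu : ∀ i x y, u i x ≤ u i y → x.1 i ≤ y.1 i)
    {σ : Finset ((Finset.univ : Finset ι).piAntidiag N)} {C : Finset ι} (h : IsDominant u σ C)
    {x z : (Finset.univ : Finset ι).piAntidiag N} (hx : x ∈ σ) (hz : z ∈ σ) (j : ι) :
    x.1 j ≤ z.1 j + Fintype.card ι ∧ (j ∉ C → z.1 j ≤ Fintype.card ι) := by
  have hσ : σ.Nonempty := ⟨x, hx⟩
  have hmem : ∀ w : (Finset.univ : Finset ι).piAntidiag N, ∑ i, w.1 i = N :=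
    fun w => (Finset.mem_piAntidiag.1 w.2).1
  let μ : ι → ℕ := fun i => σ.inf' hσ fun w => w.1 i
  have hμ : ∀ w ∈ σ, ∀ i, μ i ≤ w.1 i := fun w hw i => Finset.inf'_le (fun w => w.1 i) hw
  have hsum : N < ∑ i ∈ C, (μ i + 1) := by
    by_contra! hN
    let y : ι → ℕ := fun i =>
      (if i ∈ C then μ i + 1 else 0) + (if i = j then N - ∑ i ∈ C, (μ i + 1) else 0)
    have hy : y ∈ (Finset.univ : Finset ι).piAntidiag N := by
      rw [Finset.mem_piAntidiag]
      refine ⟨?_, by simp⟩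
      simp only [y, Finset.sum_add_distrib, Finset.sum_ite_mem, Finset.univ_inter,
        Finset.sum_ite_eq', Finset.mem_univ, if_true] at hN ⊢
      omega
    obtain ⟨i, hi, hle⟩ := h ⟨y, hy⟩
    obtain ⟨w, hw, hwi⟩ := Finset.exists_mem_eq_inf' hσ fun w => w.1 i
    have h1 := hu i _ _ (hle w hw)
    have h2 : μ i = w.1 i := hwi
    simp only [y, hi, if_true] at h1
    omega
  rw [Finset.sum_add_distrib, Finset.sum_const, smul_eq_mul, mul_one] at hsum
  have hC : C.card ≤ Fintype.card ι := Finset.card_le_univ C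
  by_cases hj : j ∈ C
  · have h1 : x.1 j + ∑ i ∈ C.erase j, μ i ≤ N := by
      calc x.1 j + ∑ i ∈ C.erase j, μ i ≤ x.1 j + ∑ i ∈ C.erase j, x.1 i := by
            gcongr with i; exact hμ x hx i
        _ = ∑ i ∈ C, x.1 i := Finset.add_sum_erase _ _ hj
        _ ≤ ∑ i, x.1 i := Finset.sum_le_sum_of_subset (Finset.subset_univ C)
        _ = N := hmem x
    rw [← Finset.add_sum_erase _ _ hj] at hsum
    have := hμ z hz j
    exact ⟨by omega, fun h => absurd hj h⟩
  · have h1 : ∀ w ∈ σ, w.1 j + ∑ i ∈ C, μ i ≤ N := by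
      intro w hw
      calc w.1 j + ∑ i ∈ C, μ i ≤ w.1 j + ∑ i ∈ C, w.1 i := by
            gcongr with i; exact hμ w hw i
        _ = ∑ i ∈ insert j C, w.1 i := (Finset.sum_insert hj).symm
        _ ≤ ∑ i, w.1 i := Finset.sum_le_sum_of_subset (Finset.subset_univ _)
        _ = N := hmem w
    have hx' := h1 x hx
    have hz' := h1 z hz
    exact ⟨by omega, fun _ => by omega⟩

theorem exists_apply_le_of_mem_stdSimplex [Nonempty ι] {x y : ι → ℝ}
    (hx : x ∈ stdSimplex ℝ ι) (hy : y ∈ stdSimplex ℝ ι) : ∃ i, x i ≤ y i := by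
  by_contra! h
  have := Finset.sum_lt_sum_of_nonempty Finset.univ_nonempty fun i _ => h i
  rw [hx.2, hy.2] at this
  exact lt_irrefl _ this

/-- A self-map of the standard simplex has points that are nearly sub-fixed in each coordinate and
arbitrarily close to each other. -/
theorem exists_approx_le_stdSimplex [Nonempty ι] {f : (ι → ℝ) → ι → ℝ}
    (hf : Set.MapsTo f (stdSimplex ℝ ι) (stdSimplex ℝ ι)) {N : ℕ} (hN : 0 < N) :
    ∃ z ∈ stdSimplex ℝ ι, ∀ i, ∃ x ∈ stdSimplex ℝ ι,
      dist x z ≤ Fintype.card ι / N ∧ z i ≤ f x i + Fintype.card ι / N := by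
  classical
  have hN' : (0 : ℝ) < N := by exact_mod_cast hN
  let T := (Finset.univ : Finset ι).piAntidiag N
  let e : T ≃ Fin (Fintype.card T) := Fintype.equivFin T
  let u : ι → T → ℕ ×ₗ Fin (Fintype.card T) := fun i x => toLex (x.1 i, e x)
  have hinj : ∀ i, Function.Injective (u i) := fun i x y h =>
    e.injective (Prod.mk.inj (toLex.injective h)).2
  have hmono : ∀ i x y, u i x ≤ u i y → x.1 i ≤ y.1 i := by
    intro i x y h
    rcases (Prod.Lex.le_iff).1 h with h | h
    · exact h.le
    · exact h.1.le
  let p : T → ι → ℝ := fun x i => (x.1 i : ℝ) / N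
  have hp : ∀ x, p x ∈ stdSimplex ℝ ι := by
    intro x
    refine ⟨fun i => by positivity, ?_⟩
    have h := (Finset.mem_piAntidiag.1 x.2).1
    simp only [p]
    rw [← Finset.sum_div, ← Nat.cast_sum, h, div_self hN'.ne']
  choose c hc using fun x : T => exists_apply_le_of_mem_stdSimplex (hp x) (hf (hp x))
  obtain ⟨σ, C, hdom, himage⟩ := exists_isDominant_image_eq hinj c
  have hσ : σ.Nonempty := by
    let x : T := ⟨Pi.single (Classical.arbitrary ι) N, Finset.mem_piAntidiag.2 ⟨by simp, by simp⟩⟩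
    obtain ⟨i, hi, -⟩ := hdom x
    rw [← himage] at hi
    exact Finset.image_nonempty.1 ⟨i, hi⟩
  obtain ⟨z, hz⟩ := hσ
  have hclose : ∀ x ∈ σ, ∀ y ∈ σ, ∀ i, p x i ≤ p y i + Fintype.card ι / N := by
    intro x hx y hy i
    have h := (hdom.grid_bounds hmono hx hy i).1
    simp only [p]
    rw [← add_div]
    gcongr
    exact_mod_cast h
  refine ⟨p z, hp z, fun i => ?_⟩
  by_cases hi : i ∈ C
  · rw [← himage] at hi
    obtain ⟨x, hx, rfl⟩ := Finset.mem_image.1 hi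
    refine ⟨p x, hp x, ?_, ?_⟩
    · refine (dist_pi_le_iff (by positivity)).2 fun j => ?_
      rw [Real.dist_eq, abs_le]
      have h1 := hclose x hx z hz j
      have h2 := hclose z hz x hx j
      constructor <;> linarith
    · have h1 := hclose z hz x hx (c x)
      have h2 := hc x
      linarith
  · refine ⟨p z, hp z, by rw [dist_self]; positivity, ?_⟩
    have h1 : p z i ≤ Fintype.card ι / N := by
      simp only [p]
      gcongr
      exact_mod_cast (hdom.grid_bounds hmono hz hz i).2 hi
    have h2 := (hf (hp z)).1 i
    linarith

/-- **Brouwer's fixed point theorem** for the standard simplex. -/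
theorem exists_fixedPoint_stdSimplex [Nonempty ι] {f : (ι → ℝ) → ι → ℝ}
    (hcont : ContinuousOn f (stdSimplex ℝ ι))
    (hf : Set.MapsTo f (stdSimplex ℝ ι) (stdSimplex ℝ ι)) :
    ∃ z ∈ stdSimplex ℝ ι, f z = z := by
  choose z hz x hx hdist hle using fun k : ℕ => exists_approx_le_stdSimplex hf k.succ_pos
  obtain ⟨w, hw, φ, hφ, hlim⟩ := (isCompact_stdSimplex ℝ ι).tendsto_subseq hz
  have hzero : Tendsto (fun k : ℕ => (Fintype.card ι : ℝ) / ((φ k).succ : ℕ)) atTop (𝓝 0) :=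
    (tendsto_const_div_atTop_nhds_zero_nat _).comp
      ((tendsto_add_atTop_nat 1).comp hφ.tendsto_atTop)
  have hge : ∀ i, w i ≤ f w i := by
    intro i
    have hxlim : Tendsto (fun k => x (φ k) i) atTop (𝓝 w) := by
      refine (tendsto_iff_of_dist ?_).2 hlim
      exact squeeze_zero (fun _ => dist_nonneg) (fun k => hdist (φ k) i) hzero
    have hflim : Tendsto (fun k => f (x (φ k) i)) atTop (𝓝 (f w)) :=
      (hcont w hw).tendsto.comp (tendsto_nhdsWithin_iff.2
        ⟨hxlim, Eventually.of_forall fun k => hx (φ k) i⟩)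
    have h1 := ((continuous_apply i).tendsto (f w)).comp hflim
    have h2 := h1.add hzero
    rw [add_zero] at h2
    exact le_of_tendsto_of_tendsto' (((continuous_apply i).tendsto w).comp hlim) h2
      fun k => hle (φ k) i
  refine ⟨w, hw, funext fun i => ?_⟩
  have hsum : ∑ i, w i = ∑ i, f w i := by rw [hw.2, (hf hw).2]
  exact ((Finset.sum_eq_sum_iff_of_le fun i _ => hge i).1 hsum i (Finset.mem_univ i)).symm

/-- **Brouwer's fixed point theorem** for a box. -/
theorem exists_fixedPoint_Icc {a b : ι → ℝ} (hab : a ≤ b) {f : (ι → ℝ) → ι → ℝ}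
    (hcont : ContinuousOn f (Set.Icc a b)) (hf : Set.MapsTo f (Set.Icc a b) (Set.Icc a b)) :
    ∃ z ∈ Set.Icc a b, f z = z := by
  let L : ℝ := ∑ i, (b i - a i) + 1
  have hL : 0 < L := by
    have : 0 ≤ ∑ i, (b i - a i) := Finset.sum_nonneg fun i _ => sub_nonneg.2 (hab i)
    positivity
  let p : (Option ι → ℝ) → ι → ℝ := fun x i => min (b i) (a i + L * x (some i))
  let s : (ι → ℝ) → Option ι → ℝ := fun z o =>
    o.elim (1 - ∑ i, (z i - a i) / L) fun i => (z i - a i) / L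
  have hp : Set.MapsTo p (stdSimplex ℝ (Option ι)) (Set.Icc a b) := by
    intro x hx
    refine ⟨fun i => le_min (hab i) ?_, fun i => min_le_left _ _⟩
    have := mul_nonneg hL.le (hx.1 (some i))
    linarith
  have hs : Set.MapsTo s (Set.Icc a b) (stdSimplex ℝ (Option ι)) := by
    intro z hz
    refine ⟨?_, by simp [s, Fintype.sum_option]⟩
    rintro (_ | i)
    · have h1 : ∑ i, (z i - a i) ≤ ∑ i, (b i - a i) :=
        Finset.sum_le_sum fun i _ => sub_le_sub_right (hz.2 i) _
      simp only [s, Option.elim]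
      rw [← Finset.sum_div, sub_nonneg, div_le_one hL]
      linarith
    · exact div_nonneg (sub_nonneg.2 (hz.1 i)) hL.le
  have hps : ∀ z ∈ Set.Icc a b, p (s z) = z := by
    intro z hz
    ext i
    simp only [p, s, Option.elim]
    rw [mul_div_cancel₀ _ hL.ne', add_sub_cancel]
    exact min_eq_right (hz.2 i)
  have hpc : Continuous p := by fun_prop
  have hsc : Continuous s := by
    refine continuous_pi ?_
    rintro (_ | i) <;> simp only [s, Option.elim] <;> fun_prop
  obtain ⟨x, hx, hfix⟩ := exists_fixedPoint_stdSimplex (f := fun x => s (f (p x)))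
    (hsc.comp_continuousOn (hcont.comp hpc.continuousOn hp)) (hs.comp (hf.comp hp))
  refine ⟨p x, hp hx, ?_⟩
  conv_rhs => rw [← hfix]
  exact (hps _ (hf (hp hx))).symm

end Brouwer

theorem rowMax_eq_sup' {n : ℕ} [NeZero n] (z : Fin n → ℝ) :
    rowMax z = Finset.univ.sup' Finset.univ_nonempty z :=
  (Finset.sup'_univ_eq_ciSup z).symm

theorem rowMax_le_iff {n : ℕ} [NeZero n] {z : Fin n → ℝ} {a : ℝ} :
    rowMax z ≤ a ↔ ∀ i, z i ≤ a := by
  simp [rowMax_eq_sup']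

theorem le_rowMax {n : ℕ} [NeZero n] (z : Fin n → ℝ) (i : Fin n) : z i ≤ rowMax z :=
  rowMax_le_iff.1 le_rfl i

theorem continuous_rowMax {n : ℕ} [NeZero n] : Continuous (rowMax : (Fin n → ℝ) → ℝ) := by
  simp_rw [funext rowMax_eq_sup']
  exact Continuous.finset_sup'_apply _ fun i _ => continuous_apply i

theorem Amap_eq_sup' {m n : ℕ} (v y : Fin m → Fin n → ℝ) (k : Fin m) (j : Fin n)
    (h : (Finset.univ.erase j).Nonempty) :
    Amap v y k j = (Finset.univ.erase j).sup' h fun i => ∑ ℓ ∈ Finset.univ.erase k,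
      (rowMax (fun r => y ℓ r +
          v ℓ i * ((if r = j then (1 : ℝ) else 0) - (if r = i then (1 : ℝ) else 0)))
        - rowMax (y ℓ)) := by
  rw [Finset.sup'_eq_csSup_image, Amap]
  congr 1
  ext z
  simp [eq_comm]

theorem univ_erase_nonempty {n : ℕ} (hn : 2 ≤ n) (j : Fin n) :
    ((Finset.univ : Finset (Fin n)).erase j).Nonempty := by
  rw [← Finset.card_pos, Finset.card_erase_of_mem (Finset.mem_univ j), Finset.card_fin]
  omega

theorem continuous_Amap {m n : ℕ} (hn : 2 ≤ n) (v : Fin m → Fin n → ℝ) (k : Fin m) (j : Fin n) :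
    Continuous fun y => Amap v y k j := by
  have : NeZero n := ⟨by omega⟩
  simp_rw [fun y => Amap_eq_sup' v y k j (univ_erase_nonempty hn j)]
  refine Continuous.finset_sup'_apply _ fun i _ => continuous_finsetSum _ fun ℓ _ => ?_
  refine (continuous_rowMax.comp ?_).sub (continuous_rowMax.comp (continuous_apply ℓ))
  fun_prop

theorem Amap_le_sum {m n : ℕ} (hn : 2 ≤ n) {v : Fin m → Fin n → ℝ} (hv : ∀ k i, 0 ≤ v k i)
    (y : Fin m → Fin n → ℝ) (k : Fin m) (j : Fin n) : Amap v y k j ≤ ∑ ℓ, ∑ i, v ℓ i := by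
  have : NeZero n := ⟨by omega⟩
  rw [Amap_eq_sup' v y k j (univ_erase_nonempty hn j), Finset.sup'_le_iff]
  intro i _
  calc _ ≤ ∑ ℓ ∈ Finset.univ.erase k, v ℓ i := by
        refine Finset.sum_le_sum fun ℓ _ => ?_
        rw [sub_le_iff_le_add, rowMax_le_iff]
        intro r
        have h1 := le_rowMax (y ℓ) r
        have h2 := hv ℓ i
        split_ifs <;> linarith
    _ ≤ ∑ ℓ, v ℓ i :=
        Finset.sum_le_sum_of_subset_of_nonneg (Finset.erase_subset _ _) fun ℓ _ _ => hv ℓ i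
    _ ≤ ∑ ℓ, ∑ i, v ℓ i := Finset.sum_le_sum fun ℓ _ =>
        Finset.single_le_sum (fun i _ => hv ℓ i) (Finset.mem_univ i)

/-- Define the perturbed map `T̃` coordinatewise by
`T̃_{kj}(y) = min{ y_{kj} − h(y_k), −A_{kj}(y)·e^{h(y_k)} }`, and let
`B = [−M, 0]^{m×n}` with `M = 2V + 1`, `V = Σ_{ℓ,i} v_{ℓi}`. Then `T̃` is
continuous, maps `B` into `B`, and admits a fixed point in `B`. -/
theorem stmt_17 (m n : ℕ) (hm : 1 ≤ m) (hn : 2 ≤ n)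
    (v : Fin m → Fin n → ℝ) (hv : ∀ k i, 0 ≤ v k i) :
    Continuous (fun (y : Fin m → Fin n → ℝ) (k : Fin m) (j : Fin n) =>
        min (y k j - rowMax (y k)) (-(Amap v y k j) * Real.exp (rowMax (y k))))
    ∧ (∀ y : Fin m → Fin n → ℝ,
        (∀ k j, y k j ∈ Set.Icc (-(2 * (∑ ℓ : Fin m, ∑ i : Fin n, v ℓ i) + 1)) 0) →
        ∀ k j, min (y k j - rowMax (y k)) (-(Amap v y k j) * Real.exp (rowMax (y k)))
          ∈ Set.Icc (-(2 * (∑ ℓ : Fin m, ∑ i : Fin n, v ℓ i) + 1)) 0)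
    ∧ (∃ y : Fin m → Fin n → ℝ,
        (∀ k j, y k j ∈ Set.Icc (-(2 * (∑ ℓ : Fin m, ∑ i : Fin n, v ℓ i) + 1)) 0) ∧
        (fun (k : Fin m) (j : Fin n) =>
          min (y k j - rowMax (y k)) (-(Amap v y k j) * Real.exp (rowMax (y k)))) = y) := by
  have : NeZero n := ⟨by omega⟩
  have hV : 0 ≤ ∑ ℓ, ∑ i, v ℓ i :=
    Finset.sum_nonneg fun ℓ _ => Finset.sum_nonneg fun i _ => hv ℓ i
  have hcont : Continuous (fun (y : Fin m → Fin n → ℝ) (k : Fin m) (j : Fin n) =>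
      min (y k j - rowMax (y k)) (-(Amap v y k j) * Real.exp (rowMax (y k)))) := by
    refine continuous_pi fun k => continuous_pi fun j => ?_
    have h1 : Continuous fun y : Fin m → Fin n → ℝ => rowMax (y k) :=
      continuous_rowMax.comp (continuous_apply k)
    have h2 := continuous_Amap hn v k j
    fun_prop
  have hmaps : ∀ y : Fin m → Fin n → ℝ,
      (∀ k j, y k j ∈ Set.Icc (-(2 * (∑ ℓ : Fin m, ∑ i : Fin n, v ℓ i) + 1)) 0) →
      ∀ k j, min (y k j - rowMax (y k)) (-(Amap v y k j) * Real.exp (rowMax (y k)))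
        ∈ Set.Icc (-(2 * (∑ ℓ : Fin m, ∑ i : Fin n, v ℓ i) + 1)) 0 := by
    intro y hy k j
    have hle : rowMax (y k) ≤ 0 := rowMax_le_iff.2 fun j => (hy k j).2
    have hexp : Real.exp (rowMax (y k)) ≤ 1 := Real.exp_le_one_iff.2 hle
    refine ⟨le_min ?_ ?_, (min_le_left _ _).trans (sub_nonpos.2 (le_rowMax (y k) j))⟩
    · have := (hy k j).1
      linarith
    · have h1 := mul_le_mul_of_nonneg_right (Amap_le_sum hn hv y k j)
        (Real.exp_pos (rowMax (y k))).le
      have h2 := mul_le_mul_of_nonneg_left hexp hV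
      linarith
  refine ⟨hcont, hmaps, ?_⟩
  have hcurry : Continuous fun (w : Fin m × Fin n → ℝ) (k : Fin m) (j : Fin n) => w (k, j) := by
    fun_prop
  obtain ⟨w, hw, hfix⟩ := exists_fixedPoint_Icc (ι := Fin m × Fin n)
    (a := fun _ => -(2 * (∑ ℓ : Fin m, ∑ i : Fin n, v ℓ i) + 1)) (b := fun _ => 0)
    (f := fun w q => min (w q - rowMax fun j => w (q.1, j))
      (-(Amap v (fun k j => w (k, j)) q.1 q.2) * Real.exp (rowMax fun j => w (q.1, j))))
    (fun _ => by dsimp only; linarith)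
    (Continuous.continuousOn <| continuous_pi fun q =>
      ((continuous_apply_apply q.1 q.2).comp hcont).comp hcurry)
    (fun w hw => ⟨fun q => (hmaps (fun k j => w (k, j))
        (fun k j => ⟨hw.1 (k, j), hw.2 (k, j)⟩) q.1 q.2).1,
      fun q => (hmaps (fun k j => w (k, j))
        (fun k j => ⟨hw.1 (k, j), hw.2 (k, j)⟩) q.1 q.2).2⟩)
  exact ⟨fun k j => w (k, j), fun k j => ⟨hw.1 (k, j), hw.2 (k, j)⟩,
    funext fun k => funext fun j => congrFun hfix (k, j)⟩
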